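/- arXiv:1212.0889 — 2 statements merged into one kernel-verified Lean document; each statement's English description precedes it below -/
import Mathlib

section
/- The Oseledec integrability condition holds for the return map: define j(z) = sInf {n : ℕ | 1 ≤ n ∧ F^[n] z ∈ S}, F_S z = F^[j z] z, and k(z) = sInf {n : ℕ | 1 ≤ n ∧ G^[n] (F_S z) ∈ S}, and let D z = !![1, 2*(j z); 2*(k z), 4*(j z)*(k z) + 1] : Matrix (Fin 2) (Fin 2) ℝ (the derivative of H_S at z wherever it is defined). Then the function z ↦ Real.log (max 1 ‖D z‖) is integrable on S with respect to μ (where ‖·‖ is Mathlib's norm on 2×2 real matrices): ∫_S Real.log (max 1 ‖D z‖) dμ(z) < ∞. -/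
open MeasureTheory
open scoped NNReal ENNReal

noncomputable section

instance : Fact ((0:ℝ) < 2) := ⟨by norm_num⟩

/-- The torus, as a product of two circles of circumference 2. -/
abbrev 𝕋 : Type := AddCircle (2:ℝ) × AddCircle (2:ℝ)

/-- The unique representative in `[0, 2)` of a point of the circle. -/
def θ (x : AddCircle (2:ℝ)) : ℝ := ((AddCircle.equivIco 2 0) x : ℝ)

def P : Set 𝕋 := {z | θ z.2 ≤ 1}
def Q : Set 𝕋 := {z | θ z.1 ≤ 1}
def R : Set 𝕋 := P ∪ Q
def S : Set 𝕋 := P ∩ Q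

/-- The horizontal twist map. -/
def F (z : 𝕋) : 𝕋 :=
  if θ z.2 ≤ 1 then (z.1 + (((2 * θ z.2 : ℝ) : AddCircle (2:ℝ))), z.2) else z

/-- The vertical twist map. -/
def G (z : 𝕋) : 𝕋 :=
  if θ z.1 ≤ 1 then (z.1, z.2 + (((2 * θ z.1 : ℝ) : AddCircle (2:ℝ)))) else z

/-- The linked-twist map. -/
def H : 𝕋 → 𝕋 := G ∘ F

/-- The first-return time of `T` to `S`. -/
def rtn (T : 𝕋 → 𝕋) (z : 𝕋) : ℕ := sInf {n : ℕ | 1 ≤ n ∧ T^[n] z ∈ S}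

/-- The first-return map of `T` to `S`. -/
def retMap (T : 𝕋 → 𝕋) (z : 𝕋) : 𝕋 := T^[rtn T z] z

/-- The set of points of `S` with return time exactly `n`. -/
def Sn (n : ℕ) : Set 𝕋 := {z | z ∈ S ∧ rtn H z = n}

attribute [local instance] Matrix.normedAddCommGroup

/-- First return time of `F` to `S`. -/
def jF (z : 𝕋) : ℕ := sInf {n : ℕ | 1 ≤ n ∧ F^[n] z ∈ S}

/-- Return map of `F` to `S`. -/
def FS (z : 𝕋) : 𝕋 := F^[jF z] z

/-- Return time of `G` to `S` starting from `F_S z`. -/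
def kG (z : 𝕋) : ℕ := sInf {n : ℕ | 1 ≤ n ∧ G^[n] (FS z) ∈ S}

/-- The derivative matrix of the return map `H_S` at `z` (wherever defined). -/
def D (z : 𝕋) : Matrix (Fin 2) (Fin 2) ℝ :=
  !![1, 2 * (jF z : ℝ); 2 * (kG z : ℝ), 4 * (jF z : ℝ) * (kG z : ℝ) + 1]

section FirstReturn

variable {α : Type*}

/-- The first time `n ≥ 1` at which the orbit of `x` under `T` lies in `A`
(`0` if there is none). -/
def returnTime (T : α → α) (A : Set α) (x : α) : ℕ := sInf {n : ℕ | 1 ≤ n ∧ T^[n] x ∈ A}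

theorem lt_returnTime_iff {T : α → α} {A : Set α} {x : α} {n : ℕ} :
    n < returnTime T A x ↔
      (∃ m, 1 ≤ m ∧ T^[m] x ∈ A) ∧ ∀ m ≤ n, ¬(1 ≤ m ∧ T^[m] x ∈ A) := by
  constructor
  · intro h
    refine ⟨Nat.nonempty_of_pos_sInf (Nat.zero_lt_of_lt h), fun m hm hA => ?_⟩
    have := Nat.sInf_le (s := {n : ℕ | 1 ≤ n ∧ T^[n] x ∈ A}) hA
    unfold returnTime at h
    omega
  · rintro ⟨hne, hA⟩
    by_contra! hle
    exact hA _ hle (Nat.sInf_mem (s := {n : ℕ | 1 ≤ n ∧ T^[n] x ∈ A}) hne)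

theorem iterate_notMem_of_lt_returnTime {T : α → α} {A : Set α} {x : α} {n : ℕ} (hn : 1 ≤ n)
    (h : n < returnTime T A x) : T^[n] x ∉ A :=
  fun hA => (lt_returnTime_iff.1 h).2 n le_rfl ⟨hn, hA⟩

theorem iterate_returnTime_mem {T : α → α} {A : Set α} {x : α} (hx : x ∈ A) :
    T^[returnTime T A x] x ∈ A := by
  rcases (returnTime T A x).eq_zero_or_pos with h | h
  · simpa [h] using hx
  · exact (Nat.sInf_mem (s := {n : ℕ | 1 ≤ n ∧ T^[n] x ∈ A}) (Nat.nonempty_of_pos_sInf h)).2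

/-- If two orbits starting in `A` meet at times `n < m`, the second one visits `A` after
`m - n` steps. -/
theorem Function.Injective.eq_iterate_sub {T : α → α} (hT : T.Injective) {a b : α} {n m : ℕ}
    (hnm : n ≤ m) (h : T^[n] a = T^[m] b) : a = T^[m - n] b := by
  apply hT.iterate n
  rw [h, ← Function.iterate_add_apply, Nat.add_sub_cancel' hnm]

/-- The floors `T^n {x ∈ A | n < returnTime T A x}` of the return-time tower are disjoint. -/
theorem pairwise_disjoint_image_iterate_lt_returnTime {T : α → α} (hT : T.Injective) (A : Set α) :
    Pairwise (Function.onFun Disjoint fun n : ℕ => T^[n] '' {x ∈ A | n < returnTime T A x}) := by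
  refine (pairwise_disjoint_on _).2 fun n m hnm => Set.disjoint_left.2 ?_
  rintro _ ⟨a, ⟨ha, -⟩, rfl⟩ ⟨b, ⟨-, hb⟩, hab⟩
  have := hT.eq_iterate_sub hnm.le hab.symm
  exact iterate_notMem_of_lt_returnTime (n := m - n) (by omega) (by omega) (this ▸ ha)

theorem pairwise_disjoint_image_iterate_returnTime_eq {T : α → α} (hT : T.Injective)
    (A : Set α) :
    Pairwise (Function.onFun Disjoint
      fun n : ℕ => T^[n + 1] '' {x ∈ A | returnTime T A x = n + 1}) := by
  refine (pairwise_disjoint_on _).2 fun n m hnm => Set.disjoint_left.2 ?_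
  rintro _ ⟨a, ⟨ha, -⟩, rfl⟩ ⟨b, ⟨-, hb⟩, hab⟩
  have := hT.eq_iterate_sub (by omega) hab.symm
  exact iterate_notMem_of_lt_returnTime (n := m + 1 - (n + 1)) (by omega) (by omega) (this ▸ ha)

variable [MeasurableSpace α] {T : α → α} {A : Set α}

theorem measurable_returnTime (hT : Measurable T) (hA : MeasurableSet A) :
    Measurable (returnTime T A) := by
  refine measurable_of_Ioi fun n => ?_
  have hm (m : ℕ) : MeasurableSet {x | 1 ≤ m ∧ T^[m] x ∈ A} :=
    (MeasurableSet.const _).inter (hT.iterate m hA)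
  have : returnTime T A ⁻¹' Set.Ioi n =
      (⋃ m, {x | 1 ≤ m ∧ T^[m] x ∈ A}) ∩ ⋂ m, ⋂ (_ : m ≤ n), {x | 1 ≤ m ∧ T^[m] x ∈ A}ᶜ := by
    ext x
    simp [lt_returnTime_iff]
  rw [this]
  exact (MeasurableSet.iUnion hm).inter
    (MeasurableSet.iInter fun m => MeasurableSet.iInter fun _ => (hm m).compl)

theorem measurable_iterate_returnTime (hT : Measurable T) (hA : MeasurableSet A) :
    Measurable fun x => T^[returnTime T A x] x := by
  have : Measurable fun p : ℕ × α => T^[p.1] p.2 :=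
    measurable_from_prod_countable_right fun n => hT.iterate n
  exact this.comp ((measurable_returnTime hT hA).prodMk measurable_id)

theorem MeasurableEmbedding.iterate (hT : MeasurableEmbedding T) (n : ℕ) :
    MeasurableEmbedding T^[n] := by
  induction n with
  | zero => exact .id
  | succ n ih => exact ih.comp hT

variable {μ : Measure α}

/-- Kac's inequality. -/
theorem setLIntegral_returnTime_le (hT : MeasurePreserving T μ μ) (he : MeasurableEmbedding T)
    (hA : MeasurableSet A) : ∫⁻ x in A, (returnTime T A x : ℝ≥0∞) ∂μ ≤ μ Set.univ := by
  have hr := measurable_returnTime hT.measurable hA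
  have hs (n : ℕ) : MeasurableSet {x | n < returnTime T A x} := hr measurableSet_Ioi
  have hsum (x : α) : (returnTime T A x : ℝ≥0∞) =
      ∑' n : ℕ, {x | n < returnTime T A x}.indicator 1 x := by
    rw [tsum_eq_sum (s := Finset.range (returnTime T A x))]
    · rw [Finset.sum_congr rfl (g := fun _ => 1)]
      · simp
      · intro n hn
        simpa [Set.indicator_apply] using hn
    · intro n hn
      simpa [Set.indicator_apply] using hn
  simp_rw [hsum]
  rw [lintegral_tsum fun n => (measurable_one.indicator (hs n)).aemeasurable]
  calc ∑' n : ℕ, ∫⁻ x in A, {x | n < returnTime T A x}.indicator 1 x ∂μ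
      = ∑' n : ℕ, μ (T^[n] '' {x ∈ A | n < returnTime T A x}) := by
        congr 1
        ext n
        rw [lintegral_indicator_one (hs n), Measure.restrict_apply (hs n), Set.inter_comm,
          ← (hT.iterate n).measure_preimage_emb (he.iterate n)
            (T^[n] '' {x ∈ A | n < returnTime T A x}),
          Set.preimage_image_eq _ (he.iterate n).injective]
        rfl
    _ = μ (⋃ n, T^[n] '' {x ∈ A | n < returnTime T A x}) :=
        (measure_iUnion (pairwise_disjoint_image_iterate_lt_returnTime he.injective A)
          fun n => (he.iterate n).measurableSet_image.2 (hA.inter (hs n))).symm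
    _ ≤ μ Set.univ := measure_mono (Set.subset_univ _)

/-- The first-return map distorts integrals over `A` by a factor of at most `2`, the factor
accounting for the points that never return, which it fixes. -/
theorem setLIntegral_comp_iterate_returnTime_le (hT : MeasurePreserving T μ μ)
    (he : MeasurableEmbedding T) (hA : MeasurableSet A) (f : α → ℝ≥0∞) :
    ∫⁻ x in A, f (T^[returnTime T A x] x) ∂μ ≤ 2 * ∫⁻ x in A, f x ∂μ := by
  have hr := measurable_returnTime hT.measurable hA
  have hs (n : ℕ) : MeasurableSet {x ∈ A | returnTime T A x = n} :=
    hA.inter (hr (measurableSet_singleton n))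
  have hlev (n : ℕ) : ∫⁻ x in {x ∈ A | returnTime T A x = n}, f (T^[returnTime T A x] x) ∂μ =
      ∫⁻ x in T^[n] '' {x ∈ A | returnTime T A x = n}, f x ∂μ := by
    rw [← (hT.iterate n).setLIntegral_comp_emb (he.iterate n)]
    exact setLIntegral_congr_fun (hs n) fun x hx => by simp only [hx.2]
  have hsub (n : ℕ) : T^[n] '' {x ∈ A | returnTime T A x = n} ⊆ A := by
    rintro _ ⟨x, ⟨hx, rfl⟩, rfl⟩
    exact iterate_returnTime_mem hx
  have hcover : A = ⋃ n, {x ∈ A | returnTime T A x = n} := by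
    ext x
    simp
  calc ∫⁻ x in A, f (T^[returnTime T A x] x) ∂μ
      = ∑' n : ℕ, ∫⁻ x in {x ∈ A | returnTime T A x = n}, f (T^[returnTime T A x] x) ∂μ := by
        rw [← lintegral_iUnion hs, ← hcover]
        refine fun n m hnm => Set.disjoint_left.2 ?_
        rintro x ⟨-, hn⟩ ⟨-, hm⟩
        exact hnm (hn.symm.trans hm)
    _ = ∫⁻ x in T^[0] '' {x ∈ A | returnTime T A x = 0}, f x ∂μ +
          ∫⁻ x in ⋃ n : ℕ, T^[n + 1] '' {x ∈ A | returnTime T A x = n + 1}, f x ∂μ := by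
        simp_rw [hlev]
        rw [tsum_eq_zero_add' ENNReal.summable, lintegral_iUnion
          (fun n => (he.iterate _).measurableSet_image.2 (hs (n + 1)))
          (pairwise_disjoint_image_iterate_returnTime_eq he.injective A)]
    _ ≤ ∫⁻ x in A, f x ∂μ + ∫⁻ x in A, f x ∂μ := by
        gcongr
        · exact hsub 0
        · exact Set.iUnion_subset fun n => hsub (n + 1)
    _ = 2 * ∫⁻ x in A, f x ∂μ := (two_mul _).symm

end FirstReturn

theorem measurable_θ : Measurable θ :=
  measurable_subtype_coe.comp (AddCircle.measurableEquivIco 2 0).measurable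

theorem measurableSet_S : MeasurableSet S :=
  (measurableSet_le (measurable_θ.comp measurable_snd) measurable_const).inter
    (measurableSet_le (measurable_θ.comp measurable_fst) measurable_const)

/-- The angle by which the twists translate the circle at coordinate `x`. -/
def twistAngle (x : AddCircle (2:ℝ)) : AddCircle (2:ℝ) :=
  if θ x ≤ 1 then ((2 * θ x : ℝ) : AddCircle (2:ℝ)) else 0

theorem measurable_twistAngle : Measurable twistAngle :=
  Measurable.ite (measurableSet_le measurable_θ measurable_const)
    ((AddCircle.measurable_mk' (a := 2)).comp (measurable_θ.const_mul 2)) measurable_const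

theorem G_eq (z : 𝕋) : G z = (z.1, z.2 + twistAngle z.1) := by
  unfold G twistAngle
  split_ifs <;> simp

theorem F_eq_swap (z : 𝕋) : F z = (G z.swap).swap := by
  unfold F G
  rw [Prod.fst_swap]
  split_ifs <;> simp

theorem measurePreserving_G : MeasurePreserving G (volume : Measure 𝕋) volume := by
  have h := (MeasurePreserving.id (volume : Measure (AddCircle (2:ℝ)))).skew_product
    (μc := (volume : Measure (AddCircle (2:ℝ)))) (μd := volume)
    (g := fun x y => y + twistAngle x)
    (measurable_snd.add (measurable_twistAngle.comp measurable_fst))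
    (Filter.Eventually.of_forall fun x => map_add_right_eq_self _ _)
  rw [funext G_eq]
  exact h

theorem measurePreserving_F : MeasurePreserving F (volume : Measure 𝕋) volume := by
  have hs : MeasurePreserving (Prod.swap : 𝕋 → 𝕋) volume volume := Measure.measurePreserving_swap
  rw [funext F_eq_swap]
  exact hs.comp (measurePreserving_G.comp hs)

theorem injective_G : Function.Injective G := by
  rintro ⟨x, y⟩ ⟨x', y'⟩ h
  simp only [G_eq, Prod.mk.injEq] at h
  obtain ⟨rfl, h⟩ := h
  rw [add_right_cancel h]

theorem injective_F : Function.Injective F := by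
  rw [funext F_eq_swap]
  exact Prod.swap_injective.comp (injective_G.comp Prod.swap_injective)

theorem setLIntegral_jF_lt_top : ∫⁻ z in S, (jF z : ℝ≥0∞) < ∞ :=
  (setLIntegral_returnTime_le measurePreserving_F
    (measurePreserving_F.measurable.measurableEmbedding injective_F)
    measurableSet_S).trans_lt (measure_lt_top _ _)

theorem setLIntegral_kG_lt_top : ∫⁻ z in S, (kG z : ℝ≥0∞) < ∞ := by
  refine (setLIntegral_comp_iterate_returnTime_le measurePreserving_F
    (measurePreserving_F.measurable.measurableEmbedding injective_F) measurableSet_S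
    fun z => (returnTime G S z : ℝ≥0∞)).trans_lt ?_
  exact ENNReal.mul_lt_top (by simp) ((setLIntegral_returnTime_le measurePreserving_G
    (measurePreserving_G.measurable.measurableEmbedding injective_G)
    measurableSet_S).trans_lt (measure_lt_top _ _))

theorem measurable_jF : Measurable jF :=
  measurable_returnTime measurePreserving_F.measurable measurableSet_S

theorem measurable_kG : Measurable kG :=
  (measurable_returnTime measurePreserving_G.measurable measurableSet_S).comp
    (measurable_iterate_returnTime measurePreserving_F.measurable measurableSet_S)

theorem integrableOn_natCast {α : Type*} [MeasurableSpace α] {μ : Measure α} {s : Set α}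
    {f : α → ℕ} (hf : Measurable f) (h : ∫⁻ x in s, (f x : ℝ≥0∞) ∂μ < ∞) :
    IntegrableOn (fun x => (f x : ℝ)) s μ := by
  refine ⟨(measurable_from_nat.comp hf).aestronglyMeasurable, ?_⟩
  simpa [HasFiniteIntegral, enorm_eq_nnnorm] using h

theorem log_max_one_norm_D_le (z : 𝕋) :
    Real.log (max 1 ‖D z‖) ≤ 2 * (jF z : ℝ) + 2 * (kG z : ℝ) := by
  have hj : (0:ℝ) ≤ jF z := Nat.cast_nonneg _
  have hk : (0:ℝ) ≤ kG z := Nat.cast_nonneg _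
  have hjk := mul_nonneg hj hk
  have hD : max 1 ‖D z‖ ≤ (2 * (jF z : ℝ) + 1) * (2 * (kG z : ℝ) + 1) := by
    refine max_le (by nlinarith) ((Matrix.norm_le_iff (by positivity)).2 fun i j => ?_)
    fin_cases i <;> fin_cases j <;> simp only [D] <;> norm_num
    · nlinarith
    · nlinarith
    · nlinarith
    · rw [abs_of_nonneg (by nlinarith)]
      nlinarith
  calc Real.log (max 1 ‖D z‖)
      ≤ Real.log ((2 * (jF z : ℝ) + 1) * (2 * (kG z : ℝ) + 1)) :=
        Real.log_le_log (by positivity) hD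
    _ = Real.log (2 * (jF z : ℝ) + 1) + Real.log (2 * (kG z : ℝ) + 1) :=
        Real.log_mul (by positivity) (by positivity)
    _ ≤ 2 * (jF z : ℝ) + 2 * (kG z : ℝ) := by
        have h1 := Real.log_le_sub_one_of_pos (show 0 < 2 * (jF z : ℝ) + 1 by positivity)
        have h2 := Real.log_le_sub_one_of_pos (show 0 < 2 * (kG z : ℝ) + 1 by positivity)
        linarith

theorem measurable_comp_jF_kG (g : ℕ × ℕ → ℝ) : Measurable fun z => g (jF z, kG z) :=
  (measurable_of_countable g).comp (measurable_jF.prodMk measurable_kG)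

theorem measurable_log_max_one_norm_D : Measurable fun z : 𝕋 => Real.log (max 1 ‖D z‖) :=
  measurable_comp_jF_kG fun p => Real.log (max 1 ‖(!![1, 2 * (p.1 : ℝ); 2 * (p.2 : ℝ),
    4 * (p.1 : ℝ) * (p.2 : ℝ) + 1] : Matrix (Fin 2) (Fin 2) ℝ)‖)

/-- The Oseledec integrability condition for the return map: `log⁺ ‖DH_S‖` is integrable
on `S`. -/
theorem oseledec_integrability :
    IntegrableOn (fun z : 𝕋 => Real.log (max 1 ‖D z‖)) S (volume : Measure 𝕋) := by
  refine (((integrableOn_natCast measurable_jF setLIntegral_jF_lt_top).const_mul 2).add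
    ((integrableOn_natCast measurable_kG setLIntegral_kG_lt_top).const_mul 2)).mono'
    measurable_log_max_one_norm_D.aestronglyMeasurable (Filter.Eventually.of_forall fun z => ?_)
  rw [Real.norm_of_nonneg (Real.log_nonneg (le_max_left _ _))]
  exact log_max_one_norm_D_le z
end
end

section
/- Few returns force a long excursion: for every b > 0 there exist β > 0 and n₀ : ℕ such that for all n ≥ n₀ and every z ∈ R satisfying: (a) for every i ≤ n there exists m ≥ 1 with H^[i + m] z ∈ S (all relevant return times are finite), and (b) r(z, n) ≤ b * Real.log n, one has (N_max(z, n) : ℝ) ≥ β * n, where r(z, n) = ((Finset.Icc 1 n).filter (fun i => H^[i] z ∈ S)).card is the number of the first n images of z lying in S, and N_max(z, n) = (Finset.Icc 0 n).sup (fun i => rtn_H (H^[i] z)) is the largest return time to S along the first n iterates. -/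
open MeasureTheory
open scoped NNReal ENNReal

noncomputable section

open scoped Classical in
/-- The number of the first `n` images of `z` under `H` lying in `S`. -/
def r (z : 𝕋) (n : ℕ) : ℕ := ((Finset.Icc 1 n).filter (fun i => H^[i] z ∈ S)).card

/-- The largest return time to `S` along the first `n` iterates of `z`. -/
def Nmax (z : 𝕋) (n : ℕ) : ℕ := (Finset.Icc 0 n).sup (fun i => rtn H (H^[i] z))

lemma theta_nonneg (x : AddCircle (2:ℝ)) : 0 ≤ θ x :=
  ((AddCircle.equivIco 2 0) x).2.1

lemma theta_lt_two (x : AddCircle (2:ℝ)) : θ x < 2 := by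
  have := ((AddCircle.equivIco 2 0) x).2.2
  simpa [θ] using this

lemma coe_theta (x : AddCircle (2:ℝ)) : ((θ x : ℝ) : AddCircle (2:ℝ)) = x :=
  AddCircle.coe_equivIco

lemma theta_coe {a : ℝ} (h0 : 0 ≤ a) (h2 : a < 2) : θ (a : AddCircle (2:ℝ)) = a := by
  unfold θ
  rw [AddCircle.coe_equivIco_mk_apply]
  have : Int.fract (a / 2) = a / 2 := Int.fract_eq_self.2 ⟨by linarith, by linarith⟩
  rw [this]; ring

lemma theta_coe_sub_two {a : ℝ} (h0 : 2 ≤ a) (h2 : a < 4) :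
    θ (a : AddCircle (2:ℝ)) = a - 2 := by
  rw [← theta_coe (a := a - 2) (by linarith) (by linarith), AddCircle.coe_sub,
    AddCircle.coe_period, sub_zero]

lemma coe_two_mul_natCast (j : ℕ) : (((2 * j : ℝ)) : AddCircle (2:ℝ)) = 0 := by
  rw [AddCircle.coe_eq_zero_iff]
  exact ⟨j, by simp [mul_comm]⟩

/-- `c` is an end of `[0, 1]` and `s` the direction pointing from it into the interval. -/
def IsEnd (c s : ℝ) : Prop := (c = 0 ∧ s = 1) ∨ (c = 1 ∧ s = -1)

/-- `z` lies in `S`, at distance at most `ε` (in each coordinate) from `(0, 0)` or `(1, 1)`. -/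
def NearCorner (ε : ℝ) (z : 𝕋) : Prop :=
  ∃ c s u v : ℝ, IsEnd c s ∧ 0 ≤ u ∧ u ≤ ε ∧ 0 ≤ v ∧ v ≤ ε ∧
    z = (((c + s * u : ℝ) : AddCircle (2:ℝ)), ((c + s * v : ℝ) : AddCircle (2:ℝ)))

lemma IsEnd.theta_coe {c s u : ℝ} (h : IsEnd c s) (h0 : 0 ≤ u) (h1 : u ≤ 1) :
    θ ((c + s * u : ℝ) : AddCircle (2:ℝ)) = c + s * u := by
  rcases h with ⟨rfl, rfl⟩ | ⟨rfl, rfl⟩ <;> apply _root_.theta_coe <;> linarith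

lemma IsEnd.le_one {c s u : ℝ} (h : IsEnd c s) (h0 : 0 ≤ u) (h1 : u ≤ 1) :
    c + s * u ≤ 1 := by
  rcases h with ⟨rfl, rfl⟩ | ⟨rfl, rfl⟩ <;> linarith

lemma IsEnd.coe_add {c s : ℝ} (h : IsEnd c s) (u v : ℝ) :
    ((c + s * u : ℝ) : AddCircle (2:ℝ)) + ((2 * (c + s * v) : ℝ) : AddCircle (2:ℝ)) =
      ((c + s * (u + 2 * v) : ℝ) : AddCircle (2:ℝ)) := by
  rcases h with ⟨rfl, rfl⟩ | ⟨rfl, rfl⟩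
  · rw [← AddCircle.coe_add]; congr 1; ring
  · rw [← AddCircle.coe_add, show (1 + -1 * u + 2 * (1 + -1 * v) : ℝ)
      = 1 + -1 * (u + 2 * v) + 2 by ring, AddCircle.coe_add_period]

lemma NearCorner.mem_S {ε : ℝ} {z : 𝕋} (h : NearCorner ε z) (hε : ε ≤ 1) : z ∈ S := by
  obtain ⟨c, s, u, v, hc, hu, hu', hv, hv', rfl⟩ := h
  refine ⟨?_, ?_⟩
  · change θ _ ≤ 1
    rw [hc.theta_coe hv (hv'.trans hε)]
    exact hc.le_one hv (hv'.trans hε)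
  · change θ _ ≤ 1
    rw [hc.theta_coe hu (hu'.trans hε)]
    exact hc.le_one hu (hu'.trans hε)

lemma NearCorner.map_H {ε : ℝ} {z : 𝕋} (h : NearCorner ε z) (hε : 7 * ε ≤ 1) :
    NearCorner (7 * ε) (H z) := by
  obtain ⟨c, s, u, v, hc, hu, hu', hv, hv', rfl⟩ := h
  refine ⟨c, s, u + 2 * v, v + 2 * (u + 2 * v), hc, by linarith, by linarith, by linarith,
    by linarith, ?_⟩
  have hF : F (((c + s * u : ℝ) : AddCircle (2:ℝ)), ((c + s * v : ℝ) : AddCircle (2:ℝ))) =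
      (((c + s * (u + 2 * v) : ℝ) : AddCircle (2:ℝ)), ((c + s * v : ℝ) : AddCircle (2:ℝ))) := by
    unfold F
    rw [hc.theta_coe hv (by linarith), if_pos (hc.le_one hv (by linarith)), hc.coe_add]
  unfold H
  rw [Function.comp_apply, hF]
  unfold G
  rw [hc.theta_coe (by linarith) (by linarith),
    if_pos (hc.le_one (by linarith) (by linarith)), hc.coe_add]

lemma NearCorner.iterate {ε : ℝ} {z : 𝕋} (h : NearCorner ε z) (hε0 : 0 ≤ ε) (k : ℕ)
    (hk : 7 ^ k * ε ≤ 1) : NearCorner (7 ^ k * ε) (H^[k] z) := by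
  induction k with
  | zero => simpa using h
  | succ k ih =>
    have h7 : (7:ℝ) ^ (k + 1) * ε = 7 * (7 ^ k * ε) := by ring
    have hpos : 0 ≤ (7:ℝ) ^ k * ε := by positivity
    rw [h7] at hk ⊢
    rw [Function.iterate_succ_apply']
    exact (ih (by linarith)).map_H hk

/-- A rotation by `2 * t` staying out of `[0, 1]` for `k` steps is slow, so it enters `[0, 1]`
close to the end it comes from. -/
lemma rotation_entrance (x : AddCircle (2:ℝ)) {t : ℝ} (ht0 : 0 ≤ t) (ht1 : t ≤ 1) (k : ℕ)
    (hout : ∀ j ≤ k, 1 < θ (x + ((2 * j * t : ℝ) : AddCircle (2:ℝ))))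
    (hin : θ (x + ((2 * (k + 1 : ℕ) * t : ℝ) : AddCircle (2:ℝ))) ≤ 1) :
    ∃ c s δ u : ℝ, IsEnd c s ∧ t = c + s * δ ∧ 0 ≤ δ ∧ 2 * k * δ < 1 ∧
      θ (x + ((2 * (k + 1 : ℕ) * t : ℝ) : AddCircle (2:ℝ))) = c + s * u ∧
      0 ≤ u ∧ u ≤ 2 * δ := by
  have ha : 1 < θ x := by simpa using hout 0 (Nat.zero_le k)
  have ha2 := theta_lt_two x
  set a := θ x with haDef
  rcases le_total t (1 / 2) with ht | ht
  · have hx : ∀ j : ℕ, x + ((2 * j * t : ℝ) : AddCircle (2:ℝ))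
        = ((a + 2 * j * t : ℝ) : AddCircle (2:ℝ)) := fun j => by
      rw [AddCircle.coe_add, haDef, coe_theta]
    simp only [hx] at hout hin ⊢
    have key : ∀ j : ℕ, j ≤ k → a + 2 * j * t < 2 := by
      intro j
      induction j with
      | zero => intro _; simpa using ha2
      | succ j ih =>
        intro hj
        have h1 := ih (by omega)
        have h2 := hout (j + 1) hj
        by_contra! h3
        push_cast at h2 h3
        rw [theta_coe_sub_two h3 (by linarith)] at h2
        linarith
    have hk := key k le_rfl
    have hk0 : 0 ≤ 2 * (k:ℝ) * t := by positivity
    have h3 : 2 ≤ a + 2 * (k + 1 : ℕ) * t := by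
      by_contra! h3
      rw [theta_coe (by push_cast; linarith) h3] at hin
      push_cast at hin
      linarith
    rw [theta_coe_sub_two h3 (by push_cast; linarith)]
    exact ⟨0, 1, t, a + 2 * (k + 1 : ℕ) * t - 2, Or.inl ⟨rfl, rfl⟩, by ring, ht0, by linarith,
      by ring, by linarith, by push_cast; linarith⟩
  · have hx : ∀ j : ℕ, x + ((2 * j * t : ℝ) : AddCircle (2:ℝ))
        = ((a - 2 * j * (1 - t) : ℝ) : AddCircle (2:ℝ)) := fun j => by
      rw [show (2 * j * t : ℝ) = 2 * j - 2 * j * (1 - t) by ring, AddCircle.coe_sub,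
        coe_two_mul_natCast, AddCircle.coe_sub, haDef, coe_theta]
      abel
    simp only [hx] at hout hin ⊢
    have hnn : ∀ j : ℕ, 0 ≤ 2 * (j:ℝ) * (1 - t) := fun j => by
      have : 0 ≤ 1 - t := by linarith
      positivity
    have key : ∀ j : ℕ, j ≤ k → 1 < a - 2 * j * (1 - t) := by
      intro j
      induction j with
      | zero => intro _; simpa using ha
      | succ j ih =>
        intro hj
        have h1 := ih (by omega)
        have h2 := hout (j + 1) hj
        have h4 := hnn (j + 1)
        rwa [theta_coe (by push_cast; linarith) (by linarith)] at h2
    have hk := key k le_rfl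
    have h4 := hnn (k + 1)
    rw [theta_coe (by push_cast; linarith) (by linarith)] at hin ⊢
    exact ⟨1, -1, 1 - t, 1 - (a - 2 * (k + 1 : ℕ) * (1 - t)), Or.inr ⟨rfl, rfl⟩, by ring,
      by linarith, by linarith, by ring, by linarith, by push_cast; linarith⟩

lemma mapsTo_H_R {z : 𝕋} (hz : z ∈ R) : H z ∈ R := by
  have hF : F z ∈ R := by
    unfold F
    split_ifs with h
    · exact Or.inl h
    · exact hz
  change G (F z) ∈ R
  unfold G
  split_ifs with h
  · exact Or.inr h
  · exact hF

lemma iterate_H_mem_R {z : 𝕋} (hz : z ∈ R) (k : ℕ) : H^[k] z ∈ R := by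
  induction k with
  | zero => exact hz
  | succ k ih => rw [Function.iterate_succ_apply']; exact mapsTo_H_R ih

lemma two_mul_succ_mul_coe (j : ℕ) (t : ℝ) :
    ((2 * (j + 1 : ℕ) * t : ℝ) : AddCircle (2:ℝ)) =
      ((2 * j * t : ℝ) : AddCircle (2:ℝ)) + ((2 * t : ℝ) : AddCircle (2:ℝ)) := by
  rw [← AddCircle.coe_add]; congr 1; push_cast; ring

lemma iterate_H_vertical {z : 𝕋} (hQ : θ z.1 ≤ 1) {N : ℕ} (hout : ∀ m < N, H^[m] z ∉ S) :
    ∀ j ≤ N, H^[j] z = (z.1, z.2 + ((2 * j * θ z.1 : ℝ) : AddCircle (2:ℝ))) := by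
  intro j
  induction j with
  | zero => intro _; simp
  | succ j ih =>
    intro hj
    have h := ih (by omega)
    have hS := hout j (by omega)
    rw [Function.iterate_succ_apply', h]
    rw [h] at hS
    have hP : ¬ θ (z.2 + ((2 * j * θ z.1 : ℝ) : AddCircle (2:ℝ))) ≤ 1 := fun hP => hS ⟨hP, hQ⟩
    simp only [H, Function.comp_apply, F, if_neg hP, G, if_pos hQ]
    rw [two_mul_succ_mul_coe, add_assoc]

lemma iterate_H_horizontal {z : 𝕋} (hP : θ z.2 ≤ 1) {k : ℕ}
    (hout : ∀ j ≤ k, 1 < θ (z.1 + ((2 * j * θ z.2 : ℝ) : AddCircle (2:ℝ)))) :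
    ∀ j ≤ k, H^[j] z = (z.1 + ((2 * j * θ z.2 : ℝ) : AddCircle (2:ℝ)), z.2) := by
  intro j
  induction j with
  | zero => intro _; simp
  | succ j ih =>
    intro hj
    have hQ := hout (j + 1) hj
    rw [two_mul_succ_mul_coe, ← add_assoc] at hQ ⊢
    rw [Function.iterate_succ_apply', ih (by omega)]
    simp only [H, Function.comp_apply, F, if_pos hP, G, if_neg hQ.not_ge]

lemma nearCorner_of_vertical {z : 𝕋} (hQ : θ z.1 ≤ 1) {k : ℕ} (hk : 1 ≤ k)
    (hout : ∀ m < k + 1, H^[m] z ∉ S) (hin : H^[k + 1] z ∈ S) :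
    NearCorner (1 / k) (H^[k + 1] z) := by
  have hit := iterate_H_vertical hQ hout
  have hin' := hin
  rw [hit _ le_rfl] at hin' ⊢
  obtain ⟨c, s, δ, u, hc, ht, hδ, hkδ, hu, hu0, hu1⟩ :=
    rotation_entrance z.2 (theta_nonneg z.1) hQ k (fun j hj => by
      have hS := hout j (by omega)
      rw [hit j (by omega)] at hS
      by_contra! hle
      exact hS ⟨hle, hQ⟩) hin'.1
  have hk' : (0:ℝ) < k := by exact_mod_cast hk
  have h2δ : 2 * δ ≤ 1 / k := by rw [le_div_iff₀ hk']; linarith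
  refine ⟨c, s, δ, u, hc, hδ, by linarith, hu0, by linarith, ?_⟩
  rw [← hu, coe_theta, ← ht, coe_theta]

lemma nearCorner_of_avoid {z : 𝕋} (hz : z ∈ R) {N : ℕ} (hN : 12 ≤ N)
    (hout : ∀ m < N, H^[m] z ∉ S) (hin : H^[N] z ∈ S) :
    NearCorner (10 / N) (H^[N] z) := by
  have hN' : (12:ℝ) ≤ N := by exact_mod_cast hN
  have mono : ∀ {ε : ℝ} {w : 𝕋}, NearCorner ε w → ε ≤ 10 / N → NearCorner (10 / N) w := by
    rintro ε w ⟨c, s, u, v, hc, hu, hu', hv, hv', rfl⟩ hε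
    exact ⟨c, s, u, v, hc, hu, hu'.trans hε, hv, hv'.trans hε, rfl⟩
  have vert : ∀ i, 2 * i < N → θ (H^[i] z).1 ≤ 1 → NearCorner (10 / N) (H^[N] z) := by
    intro i hi hQ
    obtain ⟨k, rfl⟩ : ∃ k, N = k + 1 + i := ⟨N - i - 1, by omega⟩
    rw [Function.iterate_add_apply] at hin ⊢
    refine mono (nearCorner_of_vertical hQ (by omega) (fun m hm => ?_) hin) ?_
    · rw [← Function.iterate_add_apply]; exact hout _ (by omega)
    · have hk : (1:ℝ) ≤ k := by exact_mod_cast (by omega : 1 ≤ k)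
      have hi' : (i:ℝ) ≤ k := by exact_mod_cast (by omega : i ≤ k)
      rw [div_le_div_iff₀ (by linarith) (by linarith)]
      push_cast
      linarith
  by_cases hQ : θ z.1 ≤ 1
  · exact vert 0 (by omega) hQ
  have hP : θ z.2 ≤ 1 := hz.resolve_right hQ
  set w : ℕ → AddCircle (2:ℝ) := fun j => z.1 + ((2 * j * θ z.2 : ℝ) : AddCircle (2:ℝ)) with hw
  have hex : ∃ j, θ (w j) ≤ 1 := by
    by_contra! hno
    have h := iterate_H_horizontal hP (k := N) (fun j _ => hno j) N le_rfl
    rw [h] at hin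
    exact (hno N).not_ge hin.2
  classical
  have hfind := Nat.find_spec hex
  have hmin : ∀ j < Nat.find hex, 1 < θ (w j) := fun j hj => not_le.1 (Nat.find_min hex hj)
  have hne : Nat.find hex ≠ 0 := by
    intro h0
    rw [h0] at hfind
    exact hQ (by simpa [hw] using hfind)
  obtain ⟨k, hk⟩ := Nat.exists_eq_succ_of_ne_zero hne
  rw [Nat.succ_eq_add_one] at hk
  rw [hk] at hfind hmin
  have hmin' : ∀ j ≤ k, 1 < θ (w j) := fun j hj => hmin j (by omega)
  have hit := iterate_H_horizontal hP hmin'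
  have hstep : H^[k + 1] z = (w (k + 1), z.2 + ((2 * θ (w (k + 1)) : ℝ) : AddCircle (2:ℝ))) := by
    have hwk : w (k + 1) = w k + ((2 * θ z.2 : ℝ) : AddCircle (2:ℝ)) := by
      simp only [hw]; rw [two_mul_succ_mul_coe, add_assoc]
    have hG := hfind
    rw [Function.iterate_succ_apply', hit k le_rfl]
    rw [hwk] at hG ⊢
    simp only [hw] at hG ⊢
    simp only [H, Function.comp_apply, F, if_pos hP, G, if_pos hG]
  by_cases hlt : 2 * (k + 1) < N
  · exact vert (k + 1) hlt (by rw [hstep]; exact hfind)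
  have hk5 : (5:ℝ) ≤ k := by exact_mod_cast (by omega : 5 ≤ k)
  have hNk : (N:ℝ) ≤ 2 * k + 2 := by exact_mod_cast (by omega : N ≤ 2 * k + 2)
  obtain ⟨c, s, δ, u, hc, ht, hδ, hkδ, hu, hu0, hu1⟩ :=
    rotation_entrance z.1 (theta_nonneg z.2) hP k hmin' hfind
  have h5δ : 5 * δ ≤ 5 / (2 * k) := by
    rw [le_div_iff₀ (by linarith)]; nlinarith
  have hcorner : NearCorner (5 / (2 * k)) (H^[k + 1] z) := by
    refine ⟨c, s, u, δ + 2 * u, hc, hu0, by linarith, by linarith, by linarith, ?_⟩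
    rw [hstep, ← hc.coe_add, ← hu, ← ht, coe_theta, coe_theta]
  have hkN : k + 1 = N := by
    have hS := hcorner.mem_S (by rw [div_le_one (by linarith)]; linarith)
    rcases lt_trichotomy (k + 1) N with h | h | h
    · exact absurd hS (hout _ h)
    · exact h
    · have := hmin N h
      rw [hit N (by omega)] at hin
      exact absurd hin.2 this.not_ge
  rw [← hkN]
  rw [← hkN] at mono
  refine mono hcorner ?_
  rw [div_le_div_iff₀ (by linarith) (by push_cast; linarith)]
  push_cast
  linarith

lemma rtn_spec {T : 𝕋 → 𝕋} {z : 𝕋} (h : ∃ m : ℕ, 1 ≤ m ∧ T^[m] z ∈ S) :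
    1 ≤ rtn T z ∧ T^[rtn T z] z ∈ S := Nat.sInf_mem (s := {m | 1 ≤ m ∧ T^[m] z ∈ S}) h

lemma notMem_S_of_lt_rtn {T : 𝕋 → 𝕋} {z : 𝕋} {m : ℕ} (hm : 1 ≤ m) (h : m < rtn T z) :
    T^[m] z ∉ S := fun hS => Nat.notMem_of_lt_sInf h ⟨hm, hS⟩

lemma nearCorner_of_long_return {z : 𝕋} (hz : z ∈ R) (hret : ∃ m : ℕ, 1 ≤ m ∧ H^[m] z ∈ S)
    (hN : 13 ≤ rtn H z) : NearCorner (20 / rtn H z) (H^[rtn H z] z) := by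
  obtain ⟨-, hS⟩ := rtn_spec hret
  have hno := fun m hm => notMem_S_of_lt_rtn (T := H) (z := z) (m := m) hm
  generalize rtn H z = N at *
  obtain ⟨k, rfl⟩ : ∃ k, N = k + 1 := ⟨N - 1, by omega⟩
  rw [Function.iterate_succ_apply] at hS ⊢
  obtain ⟨c, s, u, v, hc, hu, hu', hv, hv', h⟩ := nearCorner_of_avoid (N := k) (mapsTo_H_R hz)
    (by omega) (fun m hm => by
      rw [← Function.iterate_succ_apply]; exact hno _ (by omega) (by omega)) hS
  have hk : (12:ℝ) ≤ k := by exact_mod_cast (by omega : 12 ≤ k)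
  have hle : (10:ℝ) / k ≤ 20 / (k + 1 : ℕ) := by
    rw [div_le_div_iff₀ (by linarith) (by push_cast; linarith)]
    push_cast
    linarith
  exact ⟨c, s, u, v, hc, hu, hu'.trans hle, hv, hv'.trans hle, h⟩

open scoped Classical in
/-- The times in `[1, n]` at which an excursion of length at least `L` ends. -/
def longReturns (z : 𝕋) (n L : ℕ) : Finset ℕ :=
  (Finset.Icc 1 n).filter
    (fun e => ∃ m ≤ n, L ≤ rtn H (H^[m] z) ∧ m + rtn H (H^[m] z) = e)

lemma iterate_add_rtn_mem_S {z : 𝕋} {m : ℕ} (h : ∃ k : ℕ, 1 ≤ k ∧ H^[m + k] z ∈ S) :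
    1 ≤ rtn H (H^[m] z) ∧ H^[m + rtn H (H^[m] z)] z ∈ S := by
  simp only [add_comm m, Function.iterate_add_apply] at h ⊢
  exact rtn_spec h

/-- A long excursion is followed by many consecutive visits to `S`, so there are few of them. -/
lemma card_longReturns_mul_le {z : 𝕋} (hz : z ∈ R) {n L k : ℕ}
    (hret : ∀ i : ℕ, i ≤ n → ∃ m : ℕ, 1 ≤ m ∧ H^[i + m] z ∈ S) (hL : 13 ≤ L)
    (hk : (7:ℝ) ^ k * 20 ≤ L) :
    (longReturns z n L).card * (k + 1) ≤ r z n + k := by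
  classical
  have hL' : (13:ℝ) ≤ L := by exact_mod_cast hL
  have hvisit : ∀ e ∈ longReturns z n L, ∀ j ≤ k, H^[e + j] z ∈ S := by
    intro e he j hj
    obtain ⟨-, m, hm, hLm, rfl⟩ := Finset.mem_filter.1 he
    have hret' : ∃ i : ℕ, 1 ≤ i ∧ H^[i] (H^[m] z) ∈ S := by
      simpa only [add_comm m, Function.iterate_add_apply] using hret m hm
    have hc := nearCorner_of_long_return (iterate_H_mem_R hz m) hret' (hL.trans hLm)
    have hLm' : (L:ℝ) ≤ rtn H (H^[m] z) := by exact_mod_cast hLm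
    have hsmall : (7:ℝ) ^ j * (20 / rtn H (H^[m] z)) ≤ 1 := by
      rw [← mul_div_assoc, div_le_one (by linarith)]
      have : (7:ℝ) ^ j ≤ 7 ^ k := pow_le_pow_right₀ (by norm_num) hj
      linarith
    have hS := (hc.iterate (by positivity) j hsmall).mem_S hsmall
    rwa [← Function.iterate_add_apply, ← Function.iterate_add_apply,
      show j + rtn H (H^[m] z) + m = m + rtn H (H^[m] z) + j by ring] at hS
  have hpred : ∀ e ∈ longReturns z n L, 1 ≤ e ∧ H^[e - 1] z ∉ S := by
    intro e he
    obtain ⟨-, m, hm, hLm, rfl⟩ := Finset.mem_filter.1 he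
    have h := notMem_S_of_lt_rtn (T := H) (z := H^[m] z) (m := rtn H (H^[m] z) - 1)
      (by omega) (by omega)
    rw [← Function.iterate_add_apply] at h
    refine ⟨by omega, ?_⟩
    rwa [show m + rtn H (H^[m] z) - 1 = rtn H (H^[m] z) - 1 + m by omega]
  have hsep : ∀ e ∈ longReturns z n L, ∀ e' ∈ longReturns z n L, e < e' → e + k + 1 < e' := by
    intro e he e' he' hlt
    by_contra! hle
    refine (hpred e' he').2 ?_
    have := hvisit e he (e' - 1 - e) (by omega)
    rwa [show e + (e' - 1 - e) = e' - 1 by omega] at this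
  have hcard : (longReturns z n L ×ˢ Finset.range (k + 1)).card ≤
      ((Finset.Icc 1 n).filter (fun i => H^[i] z ∈ S) ∪ Finset.Icc (n + 1) (n + k)).card := by
    refine Finset.card_le_card_of_injOn (fun p => p.1 + p.2) ?_ ?_
    · rintro ⟨e, j⟩ hp
      obtain ⟨he, hj⟩ := Finset.mem_product.1 hp
      have hj' : j ≤ k := Nat.lt_succ_iff.1 (Finset.mem_range.1 hj)
      have hen := Finset.mem_Icc.1 (Finset.mem_filter.1 he).1
      have hS := hvisit e he j hj'
      simp only [Finset.coe_union, Set.mem_union, Finset.mem_coe, Finset.mem_filter,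
        Finset.mem_Icc] at hen ⊢
      by_cases hle : e + j ≤ n
      · exact Or.inl ⟨⟨by omega, hle⟩, hS⟩
      · exact Or.inr (by omega)
    · rintro ⟨e, j⟩ hp ⟨e', j'⟩ hp' heq
      obtain ⟨he, hj⟩ := Finset.mem_product.1 hp
      obtain ⟨he', hj'⟩ := Finset.mem_product.1 hp'
      simp only [Finset.mem_range] at hj hj' heq he he'
      have : e = e' := by
        rcases lt_trichotomy e e' with h | h | h
        · have := hsep e he e' he' h; omega
        · exact h
        · have := hsep e' he' e he h; omega
      exact Prod.ext this (by dsimp only; omega)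
  rw [Finset.card_product, Finset.card_range] at hcard
  refine hcard.trans ((Finset.card_union_le _ _).trans (Nat.add_le_add ?_ (by simp)))
  exact le_of_eq (by unfold r; congr)

/-- Every time up to `n` belongs to a short excursion, to a long one, or to the one that is
still under way at time `n`. -/
lemma succ_le_excursions {z : 𝕋} {n : ℕ} (L : ℕ)
    (hret : ∀ i : ℕ, i ≤ n → ∃ m : ℕ, 1 ≤ m ∧ H^[i + m] z ∈ S) :
    n + 1 ≤ L * r z n + Nmax z n * (longReturns z n L).card + Nmax z n := by
  classical
  set τ : ℕ → ℕ := fun m => rtn H (H^[m] z) with hτ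
  have hτM : ∀ m ≤ n, τ m ≤ Nmax z n := fun m hm =>
    Finset.le_sup (f := fun i => rtn H (H^[i] z)) (Finset.mem_Icc.2 ⟨Nat.zero_le m, hm⟩)
  have hτS : ∀ m ≤ n, 1 ≤ τ m ∧ H^[m + τ m] z ∈ S := fun m hm =>
    iterate_add_rtn_mem_S (hret m hm)
  set A := (Finset.range (n + 1)).filter (fun m => m + τ m ≤ n ∧ τ m < L) with hA
  set B := (Finset.range (n + 1)).filter (fun m => m + τ m ≤ n ∧ L ≤ τ m) with hB
  set C := (Finset.range (n + 1)).filter (fun m => n < m + τ m) with hC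
  have fiber : ∀ (s : Finset ℕ) (D e : ℕ), (∀ m ∈ s, 1 ≤ τ m ∧ τ m ≤ D) →
      (s.filter (fun m => m + τ m = e)).card ≤ D := by
    intro s D e hs
    calc (s.filter (fun m => m + τ m = e)).card ≤ (Finset.Ico (e - D) e).card := by
          refine Finset.card_le_card fun m hm => ?_
          obtain ⟨hm, he⟩ := Finset.mem_filter.1 hm
          have := hs m hm
          exact Finset.mem_Ico.2 (by omega)
      _ ≤ D := by rw [Nat.card_Ico]; omega
  have hAcard : A.card ≤ L * r z n := by
    have := Finset.card_le_mul_card_image_of_maps_to (s := A) (f := fun m => m + τ m)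
      (t := (Finset.Icc 1 n).filter (fun i => H^[i] z ∈ S)) (fun m hm => by
        simp only [hA, Finset.mem_filter, Finset.mem_range] at hm
        have h := hτS m (by omega)
        exact Finset.mem_filter.2 ⟨Finset.mem_Icc.2 (by omega), h.2⟩) L (fun e _ =>
        fiber A L e fun m hm => by
          simp only [hA, Finset.mem_filter, Finset.mem_range] at hm
          exact ⟨(hτS m (by omega)).1, by omega⟩)
    refine this.trans (le_of_eq ?_)
    unfold r; congr
  have hBcard : B.card ≤ Nmax z n * (longReturns z n L).card :=
    Finset.card_le_mul_card_image_of_maps_to (s := B) (f := fun m => m + τ m)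
      (fun m hm => by
        simp only [hB, Finset.mem_filter, Finset.mem_range] at hm
        have h := hτS m (by omega)
        exact Finset.mem_filter.2 ⟨Finset.mem_Icc.2 (by omega), m, by omega, hm.2.2, rfl⟩) _
      (fun e _ => fiber B _ e fun m hm => by
        simp only [hB, Finset.mem_filter, Finset.mem_range] at hm
        exact ⟨(hτS m (by omega)).1, hτM m (by omega)⟩)
  have hCcard : C.card ≤ Nmax z n :=
    calc C.card ≤ (Finset.Ico (n + 1 - Nmax z n) (n + 1)).card := by
          refine Finset.card_le_card fun m hm => ?_
          simp only [hC, Finset.mem_filter, Finset.mem_range] at hm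
          have := hτM m (by omega)
          exact Finset.mem_Ico.2 (by omega)
      _ ≤ Nmax z n := by rw [Nat.card_Ico]; omega
  have hcover : Finset.range (n + 1) ⊆ A ∪ B ∪ C := by
    intro m hm
    simp only [hA, hB, hC, Finset.mem_union, Finset.mem_filter, Finset.mem_range] at hm ⊢
    omega
  have h1 := Finset.card_le_card hcover
  have h2 := Finset.card_union_le (A ∪ B) C
  have h3 := Finset.card_union_le A B
  rw [Finset.card_range] at h1
  omega

/-- Few returns force a long excursion: if an orbit segment makes at most `b log n` returns
to `S`, then some excursion has length at least `β n`. -/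
theorem few_returns_force_long_excursion :
    ∀ b : ℝ, 0 < b → ∃ β : ℝ, 0 < β ∧ ∃ n₀ : ℕ, ∀ n : ℕ, n₀ ≤ n → ∀ z ∈ R,
      (∀ i : ℕ, i ≤ n → ∃ m : ℕ, 1 ≤ m ∧ H^[i + m] z ∈ S) →
      (r z n : ℝ) ≤ b * Real.log n →
      (Nmax z n : ℝ) ≥ β * n := by
  intro b hb
  refine ⟨1 / (2 * (8 * b + 2)), by positivity, ?_⟩
  have hlim : Filter.Tendsto (fun n : ℕ => Real.exp (Real.log n / 4)) Filter.atTop Filter.atTop :=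
    Real.tendsto_exp_atTop.comp
      ((Real.tendsto_log_atTop.comp tendsto_natCast_atTop_atTop).atTop_div_const (by norm_num))
  obtain ⟨n₀, hn₀⟩ := Filter.eventually_atTop.1
    ((hlim.eventually_ge_atTop (max 20 (16 * b))).and (Filter.eventually_ge_atTop 1))
  refine ⟨n₀, fun n hn z hz hret hr => ?_⟩
  obtain ⟨hs, hn1⟩ := hn₀ n hn
  set s := Real.exp (Real.log n / 4) with hsdef
  have hs20 : 20 ≤ s := (le_max_left _ _).trans hs
  have hsb : 16 * b ≤ s := (le_max_right _ _).trans hs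
  have hlog : Real.log n = 4 * Real.log s := by rw [hsdef, Real.log_exp]; ring
  have hlogs : Real.log s ≤ s := (Real.log_le_sub_one_of_pos (by linarith)).trans (by linarith)
  have hlogpos : 0 < Real.log s := Real.log_pos (by linarith)
  have hsn : s ^ 4 = n := by
    rw [hsdef, ← Real.exp_nat_mul]
    push_cast
    rw [mul_div_cancel₀ _ (by norm_num : (4:ℝ) ≠ 0), Real.exp_log (by exact_mod_cast hn1)]
  set L := ⌈s ^ 2⌉₊ with hL
  set k := ⌊Real.log n / 8⌋₊ with hkdef
  have hL1 : s ^ 2 ≤ L := Nat.le_ceil _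
  have hL2 : (L:ℝ) < s ^ 2 + 1 := Nat.ceil_lt_add_one (by positivity)
  have hk1 : (k:ℝ) ≤ Real.log n / 8 := Nat.floor_le (by rw [hlog]; linarith)
  have hk2 : Real.log n / 8 < k + 1 := Nat.lt_floor_add_one _
  have h7 : (7:ℝ) ^ k ≤ s := by
    have h7e : (7:ℝ) ≤ Real.exp 2 := by
      rw [show (2:ℝ) = 1 + 1 by norm_num, Real.exp_add]
      nlinarith [Real.exp_one_gt_d9]
    calc (7:ℝ) ^ k ≤ Real.exp 2 ^ k := pow_le_pow_left₀ (by norm_num) h7e k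
      _ = Real.exp (k * 2) := (Real.exp_nat_mul 2 k).symm
      _ ≤ s := Real.exp_le_exp.2 (by linarith)
  have h13 : (13:ℝ) ≤ L := by nlinarith
  have hlong := card_longReturns_mul_le hz (L := L) (k := k) hret
    (by exact_mod_cast h13) (by nlinarith)
  have hcount := succ_le_excursions L hret
  set g := (longReturns z n L).card
  have hlong' : (g:ℝ) * (k + 1) ≤ r z n + k := by exact_mod_cast hlong
  have hcount' : (n:ℝ) + 1 ≤ L * r z n + Nmax z n * g + Nmax z n := by exact_mod_cast hcount
  have hg : (g:ℝ) ≤ 8 * b + 1 := by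
    have h0 : (g:ℝ) * (Real.log n / 8) ≤ g * (k + 1) :=
      mul_le_mul_of_nonneg_left hk2.le (Nat.cast_nonneg g)
    have hpos : 0 < Real.log n / 8 := by rw [hlog]; linarith
    refine le_of_mul_le_mul_right ?_ hpos
    linarith
  have hshort : (L:ℝ) * r z n ≤ n / 2 :=
    calc (L:ℝ) * r z n ≤ (2 * s ^ 2) * (4 * b * s) := by
          gcongr
          · nlinarith
          · rw [hlog] at hr; nlinarith
      _ = 16 * b * s ^ 3 / 2 := by ring
      _ ≤ s * s ^ 3 / 2 := by gcongr
      _ = n / 2 := by rw [← hsn]; ring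
  have hM : (Nmax z n : ℝ) * g ≤ Nmax z n * (8 * b + 1) := by gcongr
  rw [ge_iff_le, div_mul_eq_mul_div, div_le_iff₀ (by positivity)]
  linarith
end
end
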